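/- Let p : ℝ^n → ℂ be a polynomial function of total degree at most m and let t > 0. Then for every x ∈ ℝ^n, (πt)^{−n/2} ∫_{ℝ^n} p(x − y) e^{−‖y‖²/t} dy = Σ_{k=0}^{⌊m/2⌋} (t/4)^k (Δ^k p)(x)/k!, where Δ = Σ_{j=1}^n ∂²/∂x_j² is the Laplacian and Δ^k its k-th iterate. -/

import Mathlib

open MeasureTheory

noncomputable section

/-- The Laplacian `Δ = ∑ j ∂²/∂x_j²` acting on (complex-coefficient) polynomials in `n`
variables. -/
def polyLaplacian {n : ℕ} (p : MvPolynomial (Fin n) ℂ) : MvPolynomial (Fin n) ℂ :=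
  ∑ j : Fin n, MvPolynomial.pderiv j (MvPolynomial.pderiv j p)

namespace GaussPoly

open MvPolynomial

def g (t y : ℝ) (k : ℕ) (u : ℝ) : ℂ := ((y - u : ℝ) : ℂ) ^ k * (Real.exp (-u ^ 2 / t) : ℂ)

lemma g_integrable (t y : ℝ) (ht : 0 < t) (k : ℕ) : Integrable (g t y k) := by
  have hb : (0 : ℝ) < 1 / t := by positivity
  have h1 : ∀ j : ℕ, Integrable (fun u : ℝ => u ^ j * Real.exp (-u ^ 2 / t)) := by
    intro j
    have := integrable_rpow_mul_exp_neg_mul_sq hb (s := (j : ℝ))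
      (lt_of_lt_of_le (by norm_num) (Nat.cast_nonneg j))
    refine this.congr (Filter.Eventually.of_forall fun u => ?_)
    simp only [Real.rpow_natCast]
    congr 2
    ring
  have h2 : Integrable (fun u : ℝ => (y - u) ^ k * Real.exp (-u ^ 2 / t)) := by
    have : (fun u : ℝ => (y - u) ^ k * Real.exp (-u ^ 2 / t)) = fun u =>
        ∑ j ∈ Finset.range (k + 1),
          ((-1) ^ j * y ^ (k - j) * (k.choose j)) * (u ^ j * Real.exp (-u ^ 2 / t)) := by
      funext u
      have : y - u = -u + y := by ring
      rw [this, add_pow, Finset.sum_mul]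
      refine Finset.sum_congr rfl fun j _ => ?_
      rw [neg_pow]; ring
    rw [this]
    exact integrable_finsetSum _ fun j _ => (h1 j).const_mul _
  refine h2.ofReal.congr (Filter.Eventually.of_forall fun u => ?_)
  simp [g]

def b (t y : ℝ) (k : ℕ) : ℂ := (((Real.pi * t) ^ (-(1 : ℝ) / 2) : ℝ) : ℂ) * ∫ u, g t y k u

lemma b_zero (t y : ℝ) (ht : 0 < t) : b t y 0 = 1 := by
  have h : ∫ u, g t y 0 u = ((Real.sqrt (Real.pi * t) : ℝ) : ℂ) := by
    have h := integral_gaussian (1 / t)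
    have e : Real.pi / (1 / t) = Real.pi * t := by field_simp
    rw [e] at h
    rw [← h, ← integral_complex_ofReal]
    refine integral_congr_ae (Filter.Eventually.of_forall fun u => ?_)
    simp only [g, pow_zero, one_mul]
    congr 2
    ring
  have hp : 0 < Real.pi * t := by positivity
  rw [b, h, ← Complex.ofReal_mul, Real.sqrt_eq_rpow, ← Real.rpow_add hp]
  norm_num

lemma b_succ (t y : ℝ) (ht : 0 < t) (k : ℕ) :
    b t y (k + 1) = y * b t y k + (t / 2 : ℂ) * (k * b t y (k - 1)) := by
  have htc : (t : ℂ) ≠ 0 := by exact_mod_cast ht.ne'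
  have hd : ∀ u : ℝ, HasDerivAt (g t y k)
      (-(k : ℂ) * g t y (k - 1) u + (2 / t : ℂ) * (g t y (k + 1) u - y * g t y k u)) u := by
    intro u
    have h1 : HasDerivAt (fun u : ℝ => ((y - u) ^ k * Real.exp (-u ^ 2 / t) : ℝ))
        (((k : ℝ) * (y - u) ^ (k - 1) * (-1)) * Real.exp (-u ^ 2 / t) +
          (y - u) ^ k * (Real.exp (-u ^ 2 / t) * (-(2 * u) / t))) u := by
      have e1 : HasDerivAt (fun u : ℝ => (y - u) ^ k) ((k : ℝ) * (y - u) ^ (k - 1) * (-1)) u :=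
        ((hasDerivAt_id' u).const_sub y).pow k
      have e2 : HasDerivAt (fun u : ℝ => -u ^ 2 / t) (-(2 * u) / t) u := by
        have := (((hasDerivAt_id' u).pow 2).neg).div_const t
        simpa using this
      exact e1.mul e2.exp
    have h2 := h1.ofReal_comp
    convert h2 using 1
    · funext v; simp [g]
    · simp only [g]
      push_cast
      field_simp
      ring
  have i0 := g_integrable t y ht k
  have im := g_integrable t y ht (k - 1)
  have ip := g_integrable t y ht (k + 1)
  have isub : Integrable (fun u => g t y (k + 1) u - y * g t y k u) := ip.sub (i0.const_mul _)
  have hz := integral_eq_zero_of_hasDerivAt_of_integrable hd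
    ((im.const_mul _).add (isub.const_mul _)) i0
  rw [integral_add (im.const_mul _) (isub.const_mul _),
    integral_const_mul, integral_const_mul, integral_sub ip (i0.const_mul _),
    integral_const_mul] at hz
  simp only [b]
  have : ∫ u, g t y (k + 1) u = y * (∫ u, g t y k u) + (t / 2 : ℂ) * (k * ∫ u, g t y (k - 1) u) := by
    field_simp at hz
    linear_combination (1 / 2 : ℂ) * hz
  rw [this]
  ring

variable {n : ℕ}

def F (t : ℝ) (x : Fin n → ℝ) (p : MvPolynomial (Fin n) ℂ) (y : Fin n → ℝ) : ℂ :=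
  MvPolynomial.eval (fun i => ((x i - y i : ℝ) : ℂ)) p * (Real.exp (-(∑ i, y i ^ 2) / t) : ℂ)

lemma F_mono (t : ℝ) (x : Fin n → ℝ) (s : Fin n →₀ ℕ) (a : ℂ) :
    F t x (monomial s a) = fun y => a * ∏ i, g t (x i) (s i) (y i) := by
  funext y
  simp only [F, g, eval_monomial, Finset.prod_mul_distrib]
  rw [Finsupp.prod_fintype _ _ (by simp), mul_assoc]
  congr 2
  rw [← Complex.ofReal_prod, ← Real.exp_sum, ← Finset.sum_div, Finset.sum_neg_distrib]

lemma F_add (t : ℝ) (x : Fin n → ℝ) (p q : MvPolynomial (Fin n) ℂ) :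
    F t x (p + q) = fun y => F t x p y + F t x q y := by
  funext y; simp [F, add_mul]

lemma F_integrable (t : ℝ) (ht : 0 < t) (x : Fin n → ℝ) (p : MvPolynomial (Fin n) ℂ) :
    Integrable (F t x p) := by
  induction p using MvPolynomial.induction_on' with
  | monomial s a =>
    rw [F_mono]
    exact (Integrable.fintype_prod (fun i => g_integrable t (x i) ht (s i))).const_mul a
  | add p q hp hq =>
    rw [F_add]; exact hp.add hq

def A (t : ℝ) (ht : 0 < t) (x : Fin n → ℝ) : MvPolynomial (Fin n) ℂ →ₗ[ℂ] ℂ where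
  toFun p := (((Real.pi * t) ^ (-(n : ℝ) / 2) : ℝ) : ℂ) * ∫ y, F t x p y
  map_add' p q := by
    rw [F_add, integral_add (F_integrable t ht x p) (F_integrable t ht x q), mul_add]
  map_smul' c p := by
    have : F t x (c • p) = fun y => c * F t x p y := by
      funext y; simp [F, smul_eval, mul_assoc]
    rw [this, integral_const_mul]
    simp; ring

lemma A_mono (t : ℝ) (ht : 0 < t) (x : Fin n → ℝ) (s : Fin n →₀ ℕ) :
    A t ht x (monomial s 1) = ∏ i, b t (x i) (s i) := by
  change (((Real.pi * t) ^ (-(n : ℝ) / 2) : ℝ) : ℂ) * ∫ y, F t x (monomial s 1) y = _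
  rw [F_mono]
  simp only [one_mul]
  rw [integral_fintype_prod_volume_eq_prod (fun i u => g t (x i) (s i) u)]
  simp only [b, Finset.prod_mul_distrib, Finset.prod_const, Finset.card_univ, Fintype.card_fin]
  congr 1
  have hp : 0 ≤ Real.pi * t := by positivity
  rw [← Complex.ofReal_pow, ← Real.rpow_natCast, ← Real.rpow_mul hp]
  congr 2
  ring

lemma A_rec (t : ℝ) (ht : 0 < t) (x : Fin n → ℝ) (s : Fin n →₀ ℕ) (i : Fin n) :
    A t ht x (X i * monomial s 1) = x i * A t ht x (monomial s 1) +
      (t / 2 : ℂ) * A t ht x (pderiv i (monomial s 1)) := by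
  have e1 : (X i * monomial s 1 : MvPolynomial (Fin n) ℂ) = monomial (s + Finsupp.single i 1) 1 := by
    rw [X, monomial_mul, add_comm]; simp
  have e2 : pderiv i (monomial s (1 : ℂ)) = (s i : ℂ) • monomial (s - Finsupp.single i 1) 1 := by
    rw [pderiv_monomial, smul_monomial]; simp
  rw [e1, e2, map_smul, A_mono, A_mono, A_mono]
  rw [← Finset.mul_prod_erase _ _ (Finset.mem_univ i), ← Finset.mul_prod_erase _ _ (Finset.mem_univ i),
    ← Finset.mul_prod_erase _ _ (Finset.mem_univ i)]
  have h1 : ∏ j ∈ Finset.univ.erase i, b t (x j) ((s + Finsupp.single i 1 : Fin n →₀ ℕ) j) =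
      ∏ j ∈ Finset.univ.erase i, b t (x j) (s j) := by
    refine Finset.prod_congr rfl fun j hj => ?_
    simp [Finsupp.single_apply, (Finset.ne_of_mem_erase hj).symm]
  have h2 : ∏ j ∈ Finset.univ.erase i, b t (x j) ((s - Finsupp.single i 1 : Fin n →₀ ℕ) j) =
      ∏ j ∈ Finset.univ.erase i, b t (x j) (s j) := by
    refine Finset.prod_congr rfl fun j hj => ?_
    simp [Finsupp.single_apply, (Finset.ne_of_mem_erase hj).symm]
  rw [h1, h2]
  simp only [Finsupp.add_apply, Finsupp.tsub_apply, Finsupp.single_eq_same, smul_eq_mul]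
  rw [b_succ t (x i) ht]
  ring

def Lap : MvPolynomial (Fin n) ℂ →ₗ[ℂ] MvPolynomial (Fin n) ℂ :=
  ∑ j : Fin n, ((pderiv j).toLinearMap ∘ₗ (pderiv j).toLinearMap)

lemma Lap_apply (p : MvPolynomial (Fin n) ℂ) : Lap p = polyLaplacian p := by
  simp [Lap, polyLaplacian]

lemma Lap_iter (k : ℕ) (p : MvPolynomial (Fin n) ℂ) : (Lap ^ k) p = polyLaplacian^[k] p := by
  rw [Module.End.pow_apply]
  congr 1
  congr 1
  funext q
  exact Lap_apply q

lemma Lap_X (i : Fin n) (p : MvPolynomial (Fin n) ℂ) :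
    Lap (X i * p) = X i * Lap p + 2 * pderiv i p := by
  have : ∀ j : Fin n, pderiv j (pderiv j (X i * p)) =
      X i * pderiv j (pderiv j p) + (if j = i then 2 * pderiv i p else 0) := by
    intro j
    by_cases h : j = i
    · subst h
      simp [Derivation.leibniz, pderiv_X_self]
      ring
    · simp [Derivation.leibniz, pderiv_X_of_ne (Ne.symm h), h]
  simp only [Lap_apply, polyLaplacian, this, Finset.sum_add_distrib, ← Finset.mul_sum]
  simp

lemma Lap_pow_X (i : Fin n) (k : ℕ) (p : MvPolynomial (Fin n) ℂ) :
    (Lap ^ (k + 1)) (X i * p) = X i * (Lap ^ (k + 1)) p +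
      (2 * (k + 1) : ℂ) • (Lap ^ k) (pderiv i p) := by
  induction k generalizing p with
  | zero =>
    have hC : (C 2 : MvPolynomial (Fin n) ℂ) = 2 := map_ofNat C 2
    simp [Lap_X, smul_eq_C_mul, hC]
  | succ k ih =>
    have h2 : (2 : MvPolynomial (Fin n) ℂ) * pderiv i p = (2 : ℂ) • pderiv i p := by
      have hC : (C 2 : MvPolynomial (Fin n) ℂ) = 2 := map_ofNat C 2
      simp [smul_eq_C_mul, hC]
    rw [pow_succ, Module.End.mul_apply, Lap_X, map_add, ih, h2, map_smul]
    have h3 : (Lap ^ k) (pderiv i (Lap p)) = (Lap ^ (k + 1)) (pderiv i p) := by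
      rw [pow_succ, Module.End.mul_apply]
      congr 1
      simp only [Lap_apply, polyLaplacian, map_sum]
      refine Finset.sum_congr rfl fun j _ => ?_
      have hc : ∀ q : MvPolynomial (Fin n) ℂ, pderiv i (pderiv j q) = pderiv j (pderiv i q) := by
        intro q
        have hb : ⁅(pderiv i : Derivation ℂ (MvPolynomial (Fin n) ℂ) (MvPolynomial (Fin n) ℂ)),
            (pderiv j : Derivation ℂ (MvPolynomial (Fin n) ℂ) (MvPolynomial (Fin n) ℂ))⁆ = 0 := by
          apply MvPolynomial.derivation_ext
          intro l
          simp [Derivation.commutator_apply, pderiv_X, Pi.single_apply, apply_ite]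
        have := congrArg (fun D => D q) hb
        simpa [Derivation.commutator_apply, sub_eq_zero] using this
      rw [hc, hc]
    rw [h3, Module.End.mul_apply, add_assoc, ← add_smul]
    congr 2
    push_cast; ring

def E (t : ℝ) (x : Fin n → ℝ) (N : ℕ) (p : MvPolynomial (Fin n) ℂ) : ℂ :=
  ∑ k ∈ Finset.range N, ((t / 4 : ℝ) : ℂ) ^ k *
    MvPolynomial.eval (fun i => ((x i : ℝ) : ℂ)) ((Lap ^ k) p) / (k.factorial : ℂ)

lemma E_smul (t : ℝ) (x : Fin n → ℝ) (N : ℕ) (c : ℂ) (p : MvPolynomial (Fin n) ℂ) :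
    E t x N (c • p) = c * E t x N p := by
  simp only [E, map_smul, smul_eval, Finset.mul_sum]
  refine Finset.sum_congr rfl fun k _ => by ring

lemma E_sum (t : ℝ) (x : Fin n → ℝ) (N : ℕ) {ι : Type} (S : Finset ι)
    (f : ι → MvPolynomial (Fin n) ℂ) :
    E t x N (∑ i ∈ S, f i) = ∑ i ∈ S, E t x N (f i) := by
  simp only [E, map_sum, Finset.mul_sum, Finset.sum_div]
  rw [Finset.sum_comm]

lemma E_rec (t : ℝ) (x : Fin n → ℝ) (N : ℕ) (p : MvPolynomial (Fin n) ℂ) (i : Fin n) :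
    E t x (N + 1) (X i * p) = x i * E t x (N + 1) p + (t / 2 : ℂ) * E t x N (pderiv i p) := by
  simp only [E]
  rw [Finset.sum_range_succ', Finset.sum_range_succ' _ N, mul_add, Finset.mul_sum, Finset.mul_sum]
  rw [add_right_comm, ← Finset.sum_add_distrib]
  congr 1
  · refine Finset.sum_congr rfl fun k _ => ?_
    rw [Lap_pow_X]
    have : ((k + 1 : ℕ) : ℂ) ≠ 0 := by exact_mod_cast Nat.succ_ne_zero k
    have h2 : ((k.factorial : ℕ) : ℂ) ≠ 0 := by exact_mod_cast k.factorial_ne_zero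
    rw [Nat.factorial_succ]
    simp only [map_add, map_mul, eval_X, smul_eval]
    push_cast at this ⊢
    field_simp
    ring
  · simp

lemma main_mono (t : ℝ) (ht : 0 < t) (x : Fin n → ℝ) (d : ℕ) :
    ∀ s : Fin n →₀ ℕ, s.degree = d → ∀ N, d / 2 < N →
      A t ht x (monomial s 1) = E t x N (monomial s 1) := by
  induction d using Nat.strong_induction_on with
  | _ d ih =>
  intro s hs N hN
  obtain ⟨N, rfl⟩ : ∃ M, N = M + 1 := ⟨N - 1, by omega⟩
  by_cases h0 : s = 0
  · subst h0
    rw [A_mono]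
    have hz : ∀ k, (Lap ^ (k + 1)) (1 : MvPolynomial (Fin n) ℂ) = 0 := by
      intro k
      rw [pow_succ, Module.End.mul_apply]
      have : Lap (1 : MvPolynomial (Fin n) ℂ) = 0 := by
        rw [Lap_apply]; simp [polyLaplacian]
      rw [this, map_zero]
    have h1 : (monomial (0 : Fin n →₀ ℕ) (1 : ℂ)) = 1 := rfl
    rw [h1, E, Finset.sum_range_succ']
    simp [hz, b_zero t _ ht]
  · obtain ⟨i, hi⟩ := Finsupp.ne_iff.mp h0
    have hi' : 1 ≤ s i := Nat.one_le_iff_ne_zero.mpr hi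
    obtain ⟨r, rfl⟩ : ∃ r, s = Finsupp.single i 1 + r :=
      ⟨s - Finsupp.single i 1, (add_tsub_cancel_of_le (by simpa using hi')).symm⟩
    have e1 : (monomial (Finsupp.single i 1 + r) 1 : MvPolynomial (Fin n) ℂ) = X i * monomial r 1 := by
      rw [X, monomial_mul]; simp
    rw [map_add, Finsupp.degree_single] at hs
    rw [e1, A_rec, E_rec, ih r.degree (by omega) r rfl (N + 1) (by omega)]
    congr 2
    have e2 : pderiv i (monomial r (1 : ℂ)) = (r i : ℂ) • monomial (r - Finsupp.single i 1) 1 := by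
      rw [pderiv_monomial, smul_monomial]; simp
    rw [e2, map_smul, E_smul, smul_eq_mul]
    by_cases hr : r i = 0
    · simp [hr]
    · congr 1
      have : r = Finsupp.single i 1 + (r - Finsupp.single i 1) :=
        (add_tsub_cancel_of_le (by simpa using Nat.one_le_iff_ne_zero.mpr hr)).symm
      have hd : r.degree = 1 + (r - Finsupp.single i 1).degree := by
        conv_lhs => rw [this]
        rw [map_add, Finsupp.degree_single]
      exact ih _ (by omega) _ rfl N (by omega)

end GaussPoly

/-- Gaussian convolution of a polynomial of total degree at most `m`:
`(πt)^{-n/2} ∫ p(x-y) e^{-‖y‖²/t} dy = ∑_{k=0}^{⌊m/2⌋} (t/4)^k (Δ^k p)(x) / k!`. -/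
theorem stmt_17 {n : ℕ} (m : ℕ) (t : ℝ) (ht : 0 < t)
    (p : MvPolynomial (Fin n) ℂ) (hp : p.totalDegree ≤ m) (x : Fin n → ℝ) :
    (((Real.pi * t) ^ (-(n : ℝ) / 2) : ℝ) : ℂ) *
        ∫ y : Fin n → ℝ,
          MvPolynomial.eval (fun i => ((x i - y i : ℝ) : ℂ)) p *
            (Real.exp (-(∑ i, y i ^ 2) / t) : ℂ)
      = ∑ k ∈ Finset.range (m / 2 + 1),
          ((t / 4 : ℝ) : ℂ) ^ k *
            MvPolynomial.eval (fun i => ((x i : ℝ) : ℂ)) (polyLaplacian^[k] p) /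
              (k.factorial : ℂ) := by
  change GaussPoly.A t ht x p = _
  have hE : GaussPoly.A t ht x p = GaussPoly.E t x (m / 2 + 1) p := by
    conv_lhs => rw [p.as_sum]
    conv_rhs => rw [p.as_sum]
    rw [map_sum, GaussPoly.E_sum]
    refine Finset.sum_congr rfl fun s hs => ?_
    have hd : s.degree ≤ m := (MvPolynomial.le_totalDegree hs).trans hp
    have e : MvPolynomial.monomial s (p.coeff s) = (p.coeff s) • MvPolynomial.monomial s (1 : ℂ) := by
      rw [MvPolynomial.smul_monomial]; simp
    rw [e, map_smul, GaussPoly.E_smul, smul_eq_mul,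
      GaussPoly.main_mono t ht x s.degree s rfl (m / 2 + 1) (by omega)]
  rw [hE]
  simp only [GaussPoly.E, GaussPoly.Lap_iter]
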